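/- Let A be a commutative Noetherian local ring and let I ⊆ A[X] be a proper ideal such that A[X]/I is a finitely generated flat A-module. Suppose that the image of I under the A-algebra map A[X] → A[X,Y], X ↦ X+Y, is contained in the ideal of A[X,Y] generated by the images of I under the two maps X ↦ X and X ↦ Y. Then there is a unique monic polynomial P ∈ A[X] generating I, and this P satisfies P(X+Y) = P(X) + P(Y) in A[X,Y]. -/

import Mathlib

open Polynomial MvPolynomial

theorem aux_exists {A : Type*} [CommRing A] [IsNoetherianRing A]
    [IsLocalRing A] (I : Ideal (Polynomial A))
    (hfin : Module.Finite A (Polynomial A ⧸ I))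
    (hflat : Module.Flat A (Polynomial A ⧸ I)) :
    ∃ P : Polynomial A, P.Monic ∧ I = Ideal.span {P} := by
  have hfree : Module.Free A (Polynomial A ⧸ I) := Module.free_of_flat_of_isLocalRing
  let f : Module.End A (Polynomial A ⧸ I) :=
    LinearMap.mulLeft A (Ideal.Quotient.mk I Polynomial.X)
  have hf : ∀ q : Polynomial A, Polynomial.aeval f q 1 = Ideal.Quotient.mk I q := by
    intro q
    have h1 : f = Algebra.lmul A _ (Ideal.Quotient.mk I Polynomial.X) := rfl
    rw [h1, Polynomial.aeval_algHom_apply]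
    have h2 : Polynomial.aeval (Ideal.Quotient.mk I Polynomial.X) q
        = Ideal.Quotient.mkₐ A I (Polynomial.aeval Polynomial.X q) := by
      rw [← Polynomial.aeval_algHom_apply]; rfl
    rw [h2]
    simp
  have hm : f.charpoly.Monic := LinearMap.charpoly_monic f
  refine ⟨f.charpoly, hm, ?_⟩
  have hmem : f.charpoly ∈ I := by
    rw [← Ideal.Quotient.eq_zero_iff_mem, ← hf, LinearMap.aeval_self_charpoly]; rfl
  have hle : Ideal.span {f.charpoly} ≤ I := by
    rw [Ideal.span_le]; simpa using hmem
  refine le_antisymm ?_ hle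
  have : Module.Free A (Polynomial A ⧸ Ideal.span {f.charpoly}) := hm.free_quotient
  have : Module.Finite A (Polynomial A ⧸ Ideal.span {f.charpoly}) := hm.finite_quotient
  have hrank : Module.finrank A (Polynomial A ⧸ Ideal.span {f.charpoly}) =
      Module.finrank A (Polynomial A ⧸ I) := by
    have h1 : Module.finrank A (AdjoinRoot f.charpoly) = f.charpoly.natDegree := by
      rw [(AdjoinRoot.powerBasis' hm).finrank, AdjoinRoot.powerBasis'_dim]
    exact h1.trans (LinearMap.charpoly_natDegree f)
  let e := LinearEquiv.ofFinrankEq _ _ hrank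
  let g := Ideal.Quotient.factorₐ A hle
  have hg : Function.Surjective g := Ideal.Quotient.factor_surjective hle
  have hinj : Function.Injective g.toLinearMap := by
    have : Function.Injective (e.symm.toLinearMap ∘ₗ g.toLinearMap) :=
      OrzechProperty.injective_of_surjective_endomorphism _ (e.symm.surjective.comp hg)
    exact Function.Injective.of_comp this
  intro q hq
  rw [← Ideal.Quotient.eq_zero_iff_mem]
  apply hinj
  rw [map_zero]
  change Ideal.Quotient.factor hle (Ideal.Quotient.mk _ q) = 0
  rw [Ideal.Quotient.factor_mk]
  exact Ideal.Quotient.eq_zero_iff_mem.mpr hq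

theorem aux_additive {A : Type*} [CommRing A] [Nontrivial A] (P : Polynomial A)
    (hP : P.Monic) (h0 : P.natDegree ≠ 0) 
    (h : Polynomial.taylor Polynomial.X (P.map Polynomial.C) ∈
      Ideal.span {Polynomial.C P, P.map Polynomial.C}) :
    Polynomial.taylor Polynomial.X (P.map Polynomial.C) =
      Polynomial.C P + P.map Polynomial.C := by
  have hc : ∀ j, (Polynomial.taylor Polynomial.X (P.map Polynomial.C)).coeff j =
      Polynomial.hasseDeriv j P := by
    intro j
    have h1 : Polynomial.hasseDeriv j (P.map (Polynomial.C : A →+* Polynomial A)) =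
        (Polynomial.hasseDeriv j P).map Polynomial.C := by
      ext1 k
      simp [Polynomial.hasseDeriv_coeff]
    rw [Polynomial.taylor_coeff, h1]
    rw [Polynomial.eval_map, Polynomial.eval₂_C_X]
  set T := Polynomial.taylor Polynomial.X (P.map Polynomial.C) with hT
  have hPC : (P.map (Polynomial.C : A →+* Polynomial A)).Monic := hP.map _
  have hTm : T.Monic := by
    rw [hT, Polynomial.Monic, Polynomial.leadingCoeff_taylor]; exact hPC
  have hTd : T.natDegree = P.natDegree := by
    rw [hT, Polynomial.natDegree_taylor, hP.natDegree_map]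
  set D := T - P.map Polynomial.C - Polynomial.C P with hD
  have hDdeg : D.degree < P.degree := by
    refine (Polynomial.degree_sub_le _ _).trans_lt (max_lt ?_ ?_)
    · have := Polynomial.degree_sub_lt_left (p := T) (q := P.map Polynomial.C) ?_ hTm.ne_zero ?_
      · rwa [Polynomial.degree_eq_natDegree hTm.ne_zero, hTd,
          ← Polynomial.degree_eq_natDegree hP.ne_zero] at this
      · rw [Polynomial.degree_eq_natDegree hTm.ne_zero, hTd,
          Polynomial.degree_eq_natDegree hPC.ne_zero, hP.natDegree_map]
      · rw [hTm.leadingCoeff, hPC.leadingCoeff]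
    · refine Polynomial.degree_C_le.trans_lt ?_
      rw [Polynomial.degree_eq_natDegree hP.ne_zero]
      exact_mod_cast Nat.pos_of_ne_zero h0
  obtain ⟨a, b, hab⟩ := Ideal.mem_span_pair.1 h
  -- coefficients of D are divisible by P
  have hdiv : ∀ j, P ∣ D.coeff j := by
    intro j
    let π := Ideal.Quotient.mk (Ideal.span {P})
    have hπP : π P = 0 := Ideal.Quotient.eq_zero_iff_mem.2 (Ideal.mem_span_singleton_self P)
    have hz : D.map π = 0 := by
      have hPM : ((P.map Polynomial.C).map π).Monic := hPC.map _
      have hdvd : (P.map Polynomial.C).map π ∣ D.map π := by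
        refine ⟨b.map π - 1, ?_⟩
        rw [hD, ← hab]
        simp only [Polynomial.map_sub, Polynomial.map_add, Polynomial.map_mul, Polynomial.map_C,
          hπP, Polynomial.C_0]
        ring
      have hnt : Nontrivial (Polynomial A ⧸ Ideal.span {P}) := by
        rw [Ideal.Quotient.nontrivial_iff, Ne, Ideal.span_singleton_eq_top]
        intro hu
        exact h0 (by rw [hP.eq_one_of_isUnit hu]; simp)
      by_contra hne
      refine hPM.not_dvd_of_degree_lt hne ?_ hdvd
      refine Polynomial.degree_map_le.trans_lt ?_
      rw [hPC.degree_map, hP.degree_map]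
      exact hDdeg
    have := congrArg (fun p => p.coeff j) hz
    simp only [Polynomial.coeff_map, Polynomial.coeff_zero] at this
    exact Ideal.mem_span_singleton.1 (Ideal.Quotient.eq_zero_iff_mem.1 this)
  have hD0 : D = 0 := by
    ext1 j
    rw [Polynomial.coeff_zero]
    by_contra hne
    refine hP.not_dvd_of_degree_lt hne ?_ (hdiv j)
    rw [hD, Polynomial.coeff_sub, Polynomial.coeff_sub, hc, Polynomial.coeff_map,
      Polynomial.coeff_C]
    have hpos : (0 : WithBot ℕ) < P.degree := by
      rw [Polynomial.degree_eq_natDegree hP.ne_zero]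
      exact_mod_cast Nat.pos_of_ne_zero h0
    split_ifs with hj
    · subst hj
      rw [Polynomial.hasseDeriv_zero']
      have : P - Polynomial.C (P.coeff 0) - P = - Polynomial.C (P.coeff 0) := by ring
      rw [this, Polynomial.degree_neg]
      exact Polynomial.degree_C_le.trans_lt hpos
    · rw [sub_zero]
      refine (Polynomial.degree_sub_le _ _).trans_lt (max_lt ?_ ?_)
      · have := Polynomial.natDegree_hasseDeriv_le P j
        rw [Polynomial.degree_eq_natDegree hP.ne_zero]
        refine Polynomial.degree_le_natDegree.trans_lt ?_
        exact_mod_cast (by omega : (Polynomial.hasseDeriv j P).natDegree < P.natDegree)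
      · exact Polynomial.degree_C_le.trans_lt hpos
  rw [hD] at hD0
  linear_combination hD0



/-- Let `A` be a commutative Noetherian local ring and let `I ⊆ A[X]` be a proper ideal such that
`A[X]/I` is a finitely generated flat `A`-module. Suppose that the image of `I` under the
`A`-algebra map `A[X] → A[X,Y]`, `X ↦ X+Y`, is contained in the ideal of `A[X,Y]` generated by the
images of `I` under the two maps `X ↦ X` and `X ↦ Y`. Then there is a unique monic polynomial
`P ∈ A[X]` generating `I`, and this `P` satisfies `P(X+Y) = P(X) + P(Y)` in `A[X,Y]`. -/
theorem exists_unique_monic_additive_generator {A : Type*} [CommRing A] [IsNoetherianRing A]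
    [IsLocalRing A] (I : Ideal (Polynomial A)) (hI : I ≠ ⊤)
    (hfin : Module.Finite A (Polynomial A ⧸ I))
    (hflat : Module.Flat A (Polynomial A ⧸ I))
    (hgrp : Ideal.map (Polynomial.aeval
        (MvPolynomial.X 0 + MvPolynomial.X 1 : MvPolynomial (Fin 2) A) :
          Polynomial A →ₐ[A] MvPolynomial (Fin 2) A) I ≤
      Ideal.map (Polynomial.aeval (MvPolynomial.X 0 : MvPolynomial (Fin 2) A) :
          Polynomial A →ₐ[A] MvPolynomial (Fin 2) A) I ⊔
        Ideal.map (Polynomial.aeval (MvPolynomial.X 1 : MvPolynomial (Fin 2) A) :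
          Polynomial A →ₐ[A] MvPolynomial (Fin 2) A) I) :
    (∃! P : Polynomial A, P.Monic ∧ I = Ideal.span {P}) ∧
      ∀ P : Polynomial A, P.Monic → I = Ideal.span {P} →
        Polynomial.aeval (MvPolynomial.X 0 + MvPolynomial.X 1 : MvPolynomial (Fin 2) A) P =
          Polynomial.aeval (MvPolynomial.X 0 : MvPolynomial (Fin 2) A) P +
            Polynomial.aeval (MvPolynomial.X 1 : MvPolynomial (Fin 2) A) P := by
  have main : ∀ P : Polynomial A, P.Monic → I = Ideal.span {P} →
        Polynomial.aeval (MvPolynomial.X 0 + MvPolynomial.X 1 : MvPolynomial (Fin 2) A) P =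
          Polynomial.aeval (MvPolynomial.X 0 : MvPolynomial (Fin 2) A) P +
            Polynomial.aeval (MvPolynomial.X 1 : MvPolynomial (Fin 2) A) P := by
    intro P hP hIP
    have h0 : P.natDegree ≠ 0 := by
      intro h
      apply hI
      rw [hIP, hP.natDegree_eq_zero.1 h]
      simp
    let φ : MvPolynomial (Fin 2) A →ₐ[A] Polynomial (Polynomial A) :=
      MvPolynomial.aeval ![Polynomial.C Polynomial.X, Polynomial.X]
    let ψ : Polynomial (Polynomial A) →+* MvPolynomial (Fin 2) A :=
      Polynomial.eval₂RingHom (Polynomial.aeval (MvPolynomial.X 0 : MvPolynomial (Fin 2) A) :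
          Polynomial A →ₐ[A] MvPolynomial (Fin 2) A).toRingHom (MvPolynomial.X 1)
    have hψφ : ψ.comp φ.toRingHom = RingHom.id _ := by
      apply MvPolynomial.ringHom_ext
      · intro r
        simp [φ, ψ, Polynomial.algebraMap_apply, MvPolynomial.algebraMap_eq]
      · intro i
        fin_cases i <;> simp [φ, ψ]
    have hinj : Function.Injective φ := by
      intro x y hxy
      have h1 := RingHom.congr_fun hψφ x
      have h2 := RingHom.congr_fun hψφ y
      change ψ (φ x) = x at h1
      change ψ (φ y) = y at h2
      rw [← h1, ← h2, hxy]
    have e0 : φ (Polynomial.aeval (MvPolynomial.X 0 : MvPolynomial (Fin 2) A) P)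
        = Polynomial.C P := by
      rw [← Polynomial.aeval_algHom_apply]
      have : φ (MvPolynomial.X 0) = Polynomial.CAlgHom (R := A) Polynomial.X := by simp [φ]
      rw [this, Polynomial.aeval_algHom_apply]
      simp
    have e1 : φ (Polynomial.aeval (MvPolynomial.X 1 : MvPolynomial (Fin 2) A) P)
        = P.map Polynomial.C := by
      rw [← Polynomial.aeval_algHom_apply]
      have : φ (MvPolynomial.X 1) = Polynomial.X := by simp [φ]
      rw [this, Polynomial.aeval_def, Polynomial.map]
      rfl
    have e2 : φ (Polynomial.aeval (MvPolynomial.X 0 + MvPolynomial.X 1 : MvPolynomial (Fin 2) A) P)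
        = Polynomial.taylor Polynomial.X (P.map Polynomial.C) := by
      rw [← Polynomial.aeval_algHom_apply]
      have : φ (MvPolynomial.X 0 + MvPolynomial.X 1)
          = Polynomial.X + Polynomial.C Polynomial.X := by simp [φ, add_comm]
      rw [this, Polynomial.taylor_apply, Polynomial.comp, Polynomial.eval₂_map,
        Polynomial.aeval_def]
      rfl
    apply hinj
    rw [map_add, e0, e1, e2]
    apply aux_additive P hP h0
    have hm : Polynomial.aeval (MvPolynomial.X 0 + MvPolynomial.X 1 : MvPolynomial (Fin 2) A) P ∈
        Ideal.span {Polynomial.aeval (MvPolynomial.X 0 : MvPolynomial (Fin 2) A) P,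
          Polynomial.aeval (MvPolynomial.X 1 : MvPolynomial (Fin 2) A) P} := by
      have h1 := hgrp (Ideal.mem_map_of_mem _ (hIP ▸ Ideal.mem_span_singleton_self P : P ∈ I))
      rw [hIP, Ideal.map_span, Ideal.map_span, Set.image_singleton, Set.image_singleton,
        ← Ideal.span_union, Set.singleton_union] at h1
      exact h1
    have h3 := Ideal.mem_map_of_mem φ hm
    rw [Ideal.map_span, Set.image_pair, e0, e1, e2] at h3
    exact h3
  refine ⟨?_, main⟩
  obtain ⟨P, hP, hIP⟩ := aux_exists I hfin hflat
  refine ⟨P, ⟨hP, hIP⟩, ?_⟩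
  rintro Q ⟨hQ, hIQ⟩
  have h1 : P ∣ Q := by
    rw [← Ideal.mem_span_singleton, ← hIP, hIQ]; exact Ideal.mem_span_singleton_self Q
  have h2 : Q ∣ P := by
    rw [← Ideal.mem_span_singleton, ← hIQ, hIP]; exact Ideal.mem_span_singleton_self P
  refine Polynomial.eq_of_monic_of_dvd_of_natDegree_le hP hQ h1 ?_
  by_contra hlt
  exact hQ.not_dvd_of_natDegree_lt hP.ne_zero (not_le.1 hlt) h2
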